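/- arXiv:1409.3323 — 4 statements merged into one kernel-verified Lean document; each statement's English description precedes it below -/
import Mathlib

section
/- There exists a constant c > 0 such that for all n, M ≥ 1, every set X ⊆ [M]^n, and every partial function f : X → Bool, the bounded-error randomized query complexity satisfies R(f) ≥ c · bs(f). -/
open scoped Classical

namespace QCPaper

/-- A partial assignment `c` is consistent with the input `x` if it agrees with `x`
wherever it is defined. -/
def Consistent {n M : ℕ} (c : Fin n → Option (Fin M)) (x : Fin n → Fin M) : Prop :=
  ∀ i : Fin n, ∀ a : Fin M, c i = some a → x i = a

/-- The size of a partial assignment: the number of indices where it is defined. -/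
def paSize {n M : ℕ} (c : Fin n → Option (Fin M)) : ℕ :=
  (Finset.univ.filter fun i => c i ≠ none).card

/-- `c` is a certificate for the partial function `f` with promise `X`:
all inputs in `X` consistent with `c` get the same value under `f`. -/
def IsCertificate {n M : ℕ} (X : Set (Fin n → Fin M)) (f : (Fin n → Fin M) → Bool)
    (c : Fin n → Option (Fin M)) : Prop :=
  ∀ x ∈ X, ∀ y ∈ X, Consistent c x → Consistent c y → f x = f y

/-- The certificate complexity of `f` at the input `x`:
the least size of a certificate for `f` consistent with `x`. -/
noncomputable def Cx {n M : ℕ} (X : Set (Fin n → Fin M)) (f : (Fin n → Fin M) → Bool)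
    (x : Fin n → Fin M) : ℕ :=
  sInf {k | ∃ c : Fin n → Option (Fin M),
    IsCertificate X f c ∧ Consistent c x ∧ paSize c = k}

/-- The certificate complexity `C(f)`: the maximum of `Cx` over inputs in the promise. -/
noncomputable def certC {n M : ℕ} (X : Set (Fin n → Fin M))
    (f : (Fin n → Fin M) → Bool) : ℕ :=
  sSup {k | ∃ x ∈ X, Cx X f x = k}

/-- `b` is a sensitive block of `x` for `f` (with promise `X`). -/
def SensBlock {n M : ℕ} (X : Set (Fin n → Fin M)) (f : (Fin n → Fin M) → Bool)
    (x : Fin n → Fin M) (b : Finset (Fin n)) : Prop :=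
  ∃ y ∈ X, f y ≠ f x ∧ ∀ i : Fin n, y i ≠ x i → i ∈ b

/-- The block sensitivity of `f` at `x`: the largest number of pairwise disjoint
sensitive blocks of `x`. -/
noncomputable def bsx {n M : ℕ} (X : Set (Fin n → Fin M)) (f : (Fin n → Fin M) → Bool)
    (x : Fin n → Fin M) : ℕ :=
  sSup {m | ∃ b : Fin m → Finset (Fin n),
    (∀ j, SensBlock X f x (b j)) ∧ ∀ j j', j ≠ j' → Disjoint (b j) (b j')}

/-- The block sensitivity `bs(f)`. -/
noncomputable def bs {n M : ℕ} (X : Set (Fin n → Fin M))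
    (f : (Fin n → Fin M) → Bool) : ℕ :=
  sSup {m | ∃ x ∈ X, bsx X f x = m}

/-- The sensitivity of `f` at `x`: the largest number of pairwise disjoint
sensitive blocks of `x`, each of size 2. -/
noncomputable def sx {n M : ℕ} (X : Set (Fin n → Fin M)) (f : (Fin n → Fin M) → Bool)
    (x : Fin n → Fin M) : ℕ :=
  sSup {m | ∃ b : Fin m → Finset (Fin n),
    (∀ j, SensBlock X f x (b j) ∧ (b j).card = 2) ∧ ∀ j j', j ≠ j' → Disjoint (b j) (b j')}

/-- The sensitivity `s(f)`. -/
noncomputable def sens {n M : ℕ} (X : Set (Fin n → Fin M))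
    (f : (Fin n → Fin M) → Bool) : ℕ :=
  sSup {m | ∃ x ∈ X, sx X f x = m}

/-- The type of an input: the multiset of its entries. -/
def typeOf {n M : ℕ} (x : Fin n → Fin M) : Multiset (Fin M) :=
  Finset.univ.val.map x

/-- The multiplicity of the alphabet element `a` in the input `x`. -/
def mult {n M : ℕ} (x : Fin n → Fin M) (a : Fin M) : ℕ :=
  (Finset.univ.filter fun i => x i = a).card

/-- A type promise: the (nonempty) set of all strings with one fixed type. -/
def IsTypePromise {n M : ℕ} (T : Set (Fin n → Fin M)) : Prop :=
  ∃ x₀ : Fin n → Fin M, T = {x | typeOf x = typeOf x₀}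

/-- Decision trees over `[M]^n`: either a leaf with a Boolean answer, or a query
to an index together with a subtree for each possible answer. -/
inductive DTree (n M : ℕ) : Type
  | leaf : Bool → DTree n M
  | node : Fin n → (Fin M → DTree n M) → DTree n M

/-- Evaluation of a decision tree on an input. -/
def DTree.eval {n M : ℕ} : DTree n M → (Fin n → Fin M) → Bool
  | .leaf b, _ => b
  | .node i ts, x => (ts (x i)).eval x

/-- The cost of a decision tree on an input: the number of queries made. -/
def DTree.cost {n M : ℕ} : DTree n M → (Fin n → Fin M) → ℕ
  | .leaf _, _ => 0
  | .node i ts, x => (ts (x i)).cost x + 1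

/-- The depth of a decision tree: its maximum cost over all inputs. -/
def DTree.depth {n M : ℕ} : DTree n M → ℕ
  | .leaf _ => 0
  | .node _ ts => (Finset.univ.sup fun a => (ts a).depth) + 1

/-- The tree `t` computes `f` on the promise `X`. -/
def Computes {n M : ℕ} (X : Set (Fin n → Fin M)) (f : (Fin n → Fin M) → Bool)
    (t : DTree n M) : Prop :=
  ∀ x ∈ X, t.eval x = f x

/-- The deterministic query complexity `D(f)`:
the least depth of a decision tree computing `f`. -/
noncomputable def detD {n M : ℕ} (X : Set (Fin n → Fin M))
    (f : (Fin n → Fin M) → Bool) : ℕ :=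
  sInf {d | ∃ t : DTree n M, Computes X f t ∧ t.depth = d}

/-- A finitely supported probability distribution over decision trees,
given as a finite list of trees with probabilities. -/
structure RandAlg (n M : ℕ) where
  N : ℕ
  tree : Fin N → DTree n M
  prob : Fin N → ℝ
  nonneg : ∀ j, 0 ≤ prob j
  sum_one : ∑ j, prob j = 1

/-- The expected cost of a randomized algorithm on the input `x`. -/
noncomputable def expCost {n M : ℕ} (A : RandAlg n M) (x : Fin n → Fin M) : ℝ :=
  ∑ j, A.prob j * ((A.tree j).cost x : ℝ)

/-- `A` is a zero-error randomized algorithm for `f`: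
every tree in its support computes `f`. -/
def ZeroError {n M : ℕ} (X : Set (Fin n → Fin M)) (f : (Fin n → Fin M) → Bool)
    (A : RandAlg n M) : Prop :=
  ∀ j, A.prob j ≠ 0 → Computes X f (A.tree j)

/-- The cost of a randomized algorithm: the maximum over inputs in the promise of
the expected cost. -/
noncomputable def algCost {n M : ℕ} (X : Set (Fin n → Fin M)) (A : RandAlg n M) : ℝ :=
  sSup {r | ∃ x ∈ X, r = expCost A x}

/-- The zero-error randomized query complexity `R₀(f)`:
the infimum cost of a zero-error randomized algorithm for `f`. -/
noncomputable def R0 {n M : ℕ} (X : Set (Fin n → Fin M))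
    (f : (Fin n → Fin M) → Bool) : ℝ :=
  sInf {r | ∃ A : RandAlg n M, ZeroError X f A ∧ algCost X A = r}

/-- `A` is a bounded-error randomized algorithm for `f`: on every input in the promise,
it returns the correct answer with probability at least 2/3. -/
def BoundedError {n M : ℕ} (X : Set (Fin n → Fin M)) (f : (Fin n → Fin M) → Bool)
    (A : RandAlg n M) : Prop :=
  ∀ x ∈ X, (2/3 : ℝ) ≤ ∑ j ∈ Finset.univ.filter fun j => (A.tree j).eval x = f x, A.prob j

/-- The depth of a randomized algorithm: the maximum depth of a tree in its support. -/
noncomputable def suppDepth {n M : ℕ} (A : RandAlg n M) : ℕ :=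
  (Finset.univ.filter fun j => A.prob j ≠ 0).sup fun j => (A.tree j).depth

/-- The bounded-error randomized query complexity `R(f)`:
the least depth of a bounded-error randomized algorithm for `f`. -/
noncomputable def randR {n M : ℕ} (X : Set (Fin n → Fin M))
    (f : (Fin n → Fin M) → Bool) : ℕ :=
  sInf {d | ∃ A : RandAlg n M, BoundedError X f A ∧ suppDepth A = d}

/-- A set of inputs is symmetric if it is invariant under permuting coordinates. -/
def SymmetricSet {n M : ℕ} (X : Set (Fin n → Fin M)) : Prop :=
  ∀ x ∈ X, ∀ σ : Equiv.Perm (Fin n), (x ∘ σ) ∈ X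

/-- A function is symmetric if its value depends only on the type of the input. -/
def SymmetricFun {n M : ℕ} (X : Set (Fin n → Fin M))
    (f : (Fin n → Fin M) → Bool) : Prop :=
  ∀ x ∈ X, ∀ y ∈ X, typeOf x = typeOf y → f x = f y

/-- The measure `d(f)` for a non-constant symmetric function: the least distance between
the types of two inputs in the promise with different values under `f`. -/
noncomputable def dgap {n M : ℕ} (X : Set (Fin n → Fin M))
    (f : (Fin n → Fin M) → Bool) : ℕ :=
  sInf {d | ∃ x ∈ X, ∃ y ∈ X, f x ≠ f y ∧
    (Finset.univ.sup fun a => Nat.dist (mult x a) (mult y a)) = d}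

/-- The set of indices queried by a decision tree on an input. -/
noncomputable def DTree.queried {n M : ℕ} : DTree n M → (Fin n → Fin M) → Finset (Fin n)
  | .leaf _, _ => ∅
  | .node i ts, x => insert i ((ts (x i)).queried x)

theorem DTree.card_queried_le_depth {n M : ℕ} (t : DTree n M) (x : Fin n → Fin M) :
    (t.queried x).card ≤ t.depth := by
  induction t with
  | leaf b => simp [DTree.queried]
  | node i ts ih =>
    simp only [DTree.queried, DTree.depth]
    refine (Finset.card_insert_le _ _).trans (Nat.add_le_add_right ((ih (x i)).trans ?_) 1)
    exact Finset.le_sup (f := fun a => (ts a).depth) (Finset.mem_univ (x i))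

theorem DTree.eval_congr_of_queried {n M : ℕ} (t : DTree n M) {x y : Fin n → Fin M}
    (h : ∀ i ∈ t.queried x, y i = x i) : t.eval y = t.eval x := by
  induction t with
  | leaf b => rfl
  | node i ts ih =>
    simp only [DTree.queried, Finset.mem_insert, forall_eq_or_imp] at h
    simp only [DTree.eval, h.1]
    exact ih (x i) h.2

theorem DTree.exists_eval_eq_of_dependsOn {n M : ℕ} (s : Finset (Fin n))
    (g : (Fin n → Fin M) → Bool) (hg : ∀ x y, (∀ i ∈ s, x i = y i) → g x = g y) :
    ∃ t : DTree n M, ∀ x, t.eval x = g x := by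
  induction s using Finset.induction_on generalizing g with
  | empty =>
    by_cases hne : Nonempty (Fin n → Fin M)
    · obtain ⟨x₀⟩ := hne
      exact ⟨.leaf (g x₀), fun x => hg _ _ (by simp)⟩
    · exact ⟨.leaf true, fun x => (hne ⟨x⟩).elim⟩
  | insert i s _ ih =>
    have hstep (a : Fin M) :
        ∃ t : DTree n M, ∀ x, t.eval x = g (Function.update x i a) := by
      refine ih _ fun x y hxy => hg _ _ fun k hk => ?_
      by_cases hki : k = i
      · subst hki; simp
      · simpa [hki] using hxy k (Finset.mem_of_mem_insert_of_ne hk hki)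
    choose ts hts using hstep
    exact ⟨.node i ts, fun x => by simp [DTree.eval, hts]⟩

theorem exists_boundedError {n M : ℕ} (X : Set (Fin n → Fin M))
    (f : (Fin n → Fin M) → Bool) : ∃ A : RandAlg n M, BoundedError X f A := by
  obtain ⟨t, ht⟩ := DTree.exists_eval_eq_of_dependsOn Finset.univ f
    fun x y h => congrArg f (funext fun i => h i (Finset.mem_univ i))
  refine ⟨⟨1, fun _ => t, fun _ => 1, fun _ => zero_le_one, by simp⟩, fun x _ => ?_⟩
  simp [ht]
  norm_num

theorem exists_boundedError_suppDepth_eq_randR {n M : ℕ} (X : Set (Fin n → Fin M))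
    (f : (Fin n → Fin M) → Bool) :
    ∃ A : RandAlg n M, BoundedError X f A ∧ suppDepth A = randR X f := by
  obtain ⟨A, hA⟩ := exists_boundedError X f
  exact Nat.sInf_mem (s := {d | ∃ A : RandAlg n M, BoundedError X f A ∧ suppDepth A = d})
    ⟨_, A, hA, rfl⟩

/-- A bounded-error algorithm queries each sensitive block with probability at least `1/3`. -/
theorem BoundedError.one_third_le_prob_query {n M : ℕ} {X : Set (Fin n → Fin M)}
    {f : (Fin n → Fin M) → Bool} {A : RandAlg n M} (hA : BoundedError X f A)
    {x : Fin n → Fin M} (hx : x ∈ X) {b : Finset (Fin n)} (hb : SensBlock X f x b) :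
    (1 / 3 : ℝ) ≤
      ∑ j, A.prob j * (if Disjoint ((A.tree j).queried x) b then 0 else 1) := by
  obtain ⟨y, hy, hne, hyb⟩ := hb
  have h1 := hA x hx
  have h2 := hA y hy
  rw [Finset.sum_filter] at h1 h2
  have hle : ∑ j, ((if (A.tree j).eval x = f x then A.prob j else 0) +
      (if (A.tree j).eval y = f y then A.prob j else 0)) ≤
      ∑ j, (A.prob j +
        A.prob j * (if Disjoint ((A.tree j).queried x) b then 0 else 1)) := by
    refine Finset.sum_le_sum fun j _ => ?_
    have hp := A.nonneg j
    by_cases hd : Disjoint ((A.tree j).queried x) b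
    · have he : (A.tree j).eval y = (A.tree j).eval x :=
        (A.tree j).eval_congr_of_queried fun i hi => by
          by_contra hi'
          exact Finset.disjoint_left.mp hd hi (hyb i hi')
      rw [he]
      by_cases hex : (A.tree j).eval x = f x
      · simp [hd, hex, hne.symm]
      · simp only [hd, hex, if_true, if_false]
        split_ifs <;> linarith
    · simp only [hd, if_false]
      split_ifs <;> linarith
  rw [Finset.sum_add_distrib, Finset.sum_add_distrib, A.sum_one] at hle
  linarith

theorem card_not_disjoint_le {ι α : Type*} [Fintype ι] [DecidableEq α] (s : Finset α)
    (b : ι → Finset α)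
    (hb : ∀ j j', j ≠ j' → Disjoint (b j) (b j')) :
    (Finset.univ.filter fun k => ¬ Disjoint s (b k)).card ≤ s.card := by
  refine Finset.card_le_card_of_forall_subsingleton (fun k i => i ∈ b k)
    (fun k hk => Finset.not_disjoint_iff.mp (by simpa using hk)) ?_
  rintro i _ k ⟨_, hk⟩ k' ⟨_, hk'⟩
  by_contra hkk
  exact Finset.disjoint_left.mp (hb k k' hkk) hk hk'

theorem BoundedError.card_le_three_mul_suppDepth {n M : ℕ} {X : Set (Fin n → Fin M)}
    {f : (Fin n → Fin M) → Bool} {A : RandAlg n M} (hA : BoundedError X f A)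
    {x : Fin n → Fin M} (hx : x ∈ X) {m : ℕ} (b : Fin m → Finset (Fin n))
    (hb : ∀ j, SensBlock X f x (b j)) (hd : ∀ j j', j ≠ j' → Disjoint (b j) (b j')) :
    m ≤ 3 * suppDepth A := by
  have hlow : (m : ℝ) * (1 / 3) ≤ ∑ k, ∑ j,
      A.prob j * (if Disjoint ((A.tree j).queried x) (b k) then 0 else 1) := by
    simpa using Finset.sum_le_sum fun k (_ : k ∈ Finset.univ) =>
      hA.one_third_le_prob_query hx (hb k)
  have hup : ∑ j, ∑ k,
      A.prob j * (if Disjoint ((A.tree j).queried x) (b k) then 0 else 1) ≤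
      ∑ j, A.prob j * (suppDepth A : ℝ) := by
    refine Finset.sum_le_sum fun j _ => ?_
    rw [← Finset.mul_sum]
    by_cases hp : A.prob j = 0
    · simp [hp]
    refine mul_le_mul_of_nonneg_left ?_ (A.nonneg j)
    have hcount : (∑ k, (if Disjoint ((A.tree j).queried x) (b k) then 0 else 1) : ℝ) =
        ((Finset.univ.filter fun k => ¬ Disjoint ((A.tree j).queried x) (b k)).card : ℝ) := by
      rw [Finset.card_filter]
      push_cast
      exact Finset.sum_congr rfl fun k _ => by split_ifs <;> simp_all
    rw [hcount]
    have hdepth : (A.tree j).depth ≤ suppDepth A := by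
      unfold suppDepth
      exact Finset.le_sup (f := fun j => (A.tree j).depth) (by simpa using hp)
    have hcard := card_not_disjoint_le ((A.tree j).queried x) b hd
    have hquery := (A.tree j).card_queried_le_depth x
    exact_mod_cast hcard.trans (hquery.trans hdepth)
  rw [Finset.sum_comm] at hlow
  rw [← Finset.sum_mul, A.sum_one, one_mul] at hup
  have : (m : ℝ) ≤ 3 * (suppDepth A : ℝ) := by linarith
  exact_mod_cast this

/-- `R(f) ≥ c · bs(f)` for every partial function. -/
theorem randR_ge_bs : ∃ c : ℝ, 0 < c ∧
    ∀ (n M : ℕ), 1 ≤ n → 1 ≤ M →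
    ∀ X : Set (Fin n → Fin M), ∀ f : (Fin n → Fin M) → Bool,
      c * (bs X f : ℝ) ≤ (randR X f : ℝ) := by
  refine ⟨1 / 3, by norm_num, fun n M _ _ X f => ?_⟩
  obtain ⟨A, hA, hdepth⟩ := exists_boundedError_suppDepth_eq_randR X f
  have hbs : bs X f ≤ 3 * randR X f := by
    refine csSup_le' ?_
    rintro _ ⟨x, hx, rfl⟩
    refine csSup_le' ?_
    rintro m ⟨b, hb, hd⟩
    exact hdepth ▸ hA.card_le_three_mul_suppDepth hx b hb hd
  have : (bs X f : ℝ) ≤ 3 * (randR X f : ℝ) := by exact_mod_cast hbs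
  linarith

end QCPaper
end

section
/- Let M ≥ 1 and let s, t : Fin M → ℕ satisfy ∑_a s a = ∑_a t a, and set D = max over a ∈ Fin M of |s a − t a| (absolute value of the integer difference). Then there exist k ≤ M and a sequence v_0, v_1, …, v_k of functions Fin M → ℕ with v_0 = s and v_k = t such that for every j < k: ∑_a v_{j+1} a = ∑_a s a; the set {a : v_j a ≠ v_{j+1} a} has at most 2 elements; max over a of |v_j a − v_{j+1} a| ≤ D; and max over a of |v_{j+1} a − t a| ≤ D. -/
open scoped Classical

namespace QCPaper

/-- If two types of equal size differ, then moving mass from one coordinate to another makes a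
further coordinate of `s` agree with `t`. -/
theorem exists_transfer {ι : Type*} [Fintype ι] {s t : ι → ℕ} {D : ℕ}
    (hsum : ∑ a, s a = ∑ a, t a) (hD : ∀ a, Nat.dist (s a) (t a) ≤ D) (hst : s ≠ t) :
    ∃ u : ι → ℕ, ∑ a, u a = ∑ a, s a ∧
      (Finset.univ.filter fun a => s a ≠ u a).card ≤ 2 ∧
      (∀ a, Nat.dist (s a) (u a) ≤ D) ∧ (∀ a, Nat.dist (u a) (t a) ≤ D) ∧
      (Finset.univ.filter fun a => u a ≠ t a).card <
        (Finset.univ.filter fun a => s a ≠ t a).card := by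
  obtain ⟨a, ha⟩ : ∃ a, t a < s a := by
    by_contra! h
    exact hst (funext fun x => (Finset.sum_eq_sum_iff_of_le fun i _ => h i).1 hsum x
      (Finset.mem_univ x))
  obtain ⟨b, hb⟩ : ∃ b, s b < t b := by
    by_contra! h
    exact hst (funext fun x => ((Finset.sum_eq_sum_iff_of_le fun i _ => h i).1 hsum.symm x
      (Finset.mem_univ x)).symm)
  have hab : b ≠ a := by rintro rfl; omega
  obtain ⟨c, hc⟩ : ∃ c, c = min (s a - t a) (t b - s b) := ⟨_, rfl⟩
  obtain ⟨u, hu⟩ : ∃ u : ι → ℕ,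
      u = fun x => if x = a then s a - c else if x = b then s b + c else s x := ⟨_, rfl⟩
  have hua : u a = s a - c := by simp [hu]
  have hub : u b = s b + c := by simp [hu, hab]
  have hux : ∀ x, x ≠ a → x ≠ b → u x = s x := fun x h h' => by simp [hu, h, h']
  have hDa := hD a
  have hDb := hD b
  simp only [Nat.dist] at hD hDa hDb ⊢
  refine ⟨u, ?_, ?_, fun x => ?_, fun x => ?_, Finset.card_lt_card ?_⟩
  · have key : ∀ x, u x + (Pi.single a c : ι → ℕ) x = s x + (Pi.single b c : ι → ℕ) x := by
      intro x
      by_cases h : x = a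
      · subst h
        simp [hua, Ne.symm hab]
        omega
      by_cases h' : x = b
      · subst h'
        simp [hub, hab]
      · simp [hux x h h', h, h']
    have hsums := Finset.sum_congr (rfl : (Finset.univ : Finset ι) = Finset.univ)
      fun x _ => key x
    simp only [Finset.sum_add_distrib, Finset.sum_pi_single', Finset.mem_univ, if_true] at hsums
    simpa using hsums
  · refine (Finset.card_le_card (t := {a, b}) fun x hx => ?_).trans Finset.card_le_two
    by_contra h
    simp only [Finset.mem_insert, Finset.mem_singleton, not_or] at h
    exact (Finset.mem_filter.1 hx).2 (hux x h.1 h.2).symm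
  · by_cases h : x = a
    · subst h; omega
    by_cases h' : x = b
    · subst h'; omega
    · rw [hux x h h']; omega
  · by_cases h : x = a
    · subst h; omega
    by_cases h' : x = b
    · subst h'; omega
    · rw [hux x h h']; exact hD x
  · refine Finset.ssubset_iff_subset_ne.2 ⟨fun x hx => ?_, fun h => ?_⟩
    · simp only [Finset.mem_filter, Finset.mem_univ, true_and] at hx ⊢
      by_cases h : x = a
      · subst h; omega
      by_cases h' : x = b
      · subst h'; omega
      · rwa [hux x h h'] at hx
    · have h₁ := Finset.ext_iff.1 h a
      have h₂ := Finset.ext_iff.1 h b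
      simp only [Finset.mem_filter, Finset.mem_univ, true_and] at h₁ h₂
      omega

/-- Iterating transfers leads from `s` to `t` in at most as many steps as there are coordinates
where they differ. -/
theorem exists_transfer_sequence {ι : Type*} [Fintype ι] {t : ι → ℕ} {D : ℕ} (n : ℕ)
    (s : ι → ℕ) (hsum : ∑ a, s a = ∑ a, t a) (hD : ∀ a, Nat.dist (s a) (t a) ≤ D)
    (hn : (Finset.univ.filter fun a => s a ≠ t a).card ≤ n) :
    ∃ k ≤ n, ∃ v : ℕ → (ι → ℕ), v 0 = s ∧ v k = t ∧
      ∀ j < k,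
        (∑ a, v (j + 1) a = ∑ a, s a) ∧
        (Finset.univ.filter fun a => v j a ≠ v (j + 1) a).card ≤ 2 ∧
        (∀ a, Nat.dist (v j a) (v (j + 1) a) ≤ D) ∧
        (∀ a, Nat.dist (v (j + 1) a) (t a) ≤ D) := by
  induction n generalizing s with
  | zero =>
    have hst : s = t := by simpa [Finset.filter_eq_empty_iff, funext_iff] using hn
    exact ⟨0, le_rfl, fun _ => s, rfl, hst, fun j hj => absurd hj j.not_lt_zero⟩
  | succ n ih =>
    by_cases hst : s = t
    · exact ⟨0, Nat.zero_le _, fun _ => s, rfl, hst, fun j hj => absurd hj j.not_lt_zero⟩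
    obtain ⟨u, husum, hcard, hsu, hut, hlt⟩ := exists_transfer hsum hD hst
    obtain ⟨k, hk, v, hv₀, hvk, hv⟩ := ih u (husum.trans hsum) hut (by omega)
    refine ⟨k + 1, by omega, fun j => Nat.casesOn j s v, rfl, hvk, ?_⟩
    rintro (_ | j) hj
    · simp only [hv₀]
      exact ⟨husum, hcard, hsu, hut⟩
    · obtain ⟨h₁, h₂⟩ := hv j (by omega)
      exact ⟨h₁.trans husum, h₂⟩

/-- the hybrid sequence of types between two types `s` and `t` of the
same total size: at most `M` steps, each changing at most two multiplicities, with all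
steps of distance at most `D` and staying within distance `D` of `t`. -/
theorem hybrid_type_sequence (M : ℕ) (hM : 1 ≤ M) (s t : Fin M → ℕ)
    (hsum : ∑ a, s a = ∑ a, t a)
    (D : ℕ) (hD : D = Finset.univ.sup fun a => Nat.dist (s a) (t a)) :
    ∃ k ≤ M, ∃ v : ℕ → (Fin M → ℕ), v 0 = s ∧ v k = t ∧
      ∀ j < k,
        (∑ a, v (j + 1) a = ∑ a, s a) ∧
        (Finset.univ.filter fun a => v j a ≠ v (j + 1) a).card ≤ 2 ∧
        (Finset.univ.sup fun a => Nat.dist (v j a) (v (j + 1) a)) ≤ D ∧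
        (Finset.univ.sup fun a => Nat.dist (v (j + 1) a) (t a)) ≤ D := by
  have hdist : ∀ a, Nat.dist (s a) (t a) ≤ D := fun a => by
    rw [hD]
    exact Finset.le_sup (f := fun a => Nat.dist (s a) (t a)) (Finset.mem_univ a)
  obtain ⟨k, hk, v, hv₀, hvk, hv⟩ := exists_transfer_sequence M s hsum hdist
    ((Finset.card_le_univ _).trans_eq (Fintype.card_fin M))
  refine ⟨k, hk, v, hv₀, hvk, fun j hj => ?_⟩
  obtain ⟨h₁, h₂, h₃, h₄⟩ := hv j hj
  exact ⟨h₁, h₂, Finset.sup_le fun a _ => h₃ a, Finset.sup_le fun a _ => h₄ a⟩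

end QCPaper
end

section
/- Let n, M ≥ 1, let x ∈ [M]^n, and for a ∈ Fin M let t_a = |{i : x i = a}|. Let d be a real number with d > 0 and let k be a natural number with k ≥ 3 (n/d)² · ln (6M). Draw k indices i_1, …, i_k independently and uniformly at random from Fin n, and for a ∈ Fin M let r_a = |{j ≤ k : x (i_j) = a}|. Then with probability at least 2/3, for every a ∈ Fin M we have |n · r_a − k · t_a| < k · d (equivalently, |(r_a/k) · n − t_a| < d). -/
open scoped Classical

namespace QCPaper

/-- Hoeffding's inequality for `k` independent uniform samples from a finite type, in counting
form. -/
theorem card_le_sum_comp_le {Ω : Type*} [Fintype Ω] (g : Ω → ℝ) (hg : ∀ i, |g i| ≤ 1)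
    (hsum : ∑ i, g i = 0) {ε : ℝ} (hε : 0 ≤ ε) (k : ℕ) :
    ((Finset.univ.filter fun s : Fin k → Ω => (k : ℝ) * ε ≤ ∑ j, g (s j)).card : ℝ) ≤
      Real.exp (-(k * ε ^ 2 / 2)) * (Fintype.card Ω : ℝ) ^ k := by
  have hmgf : ∑ i, Real.exp (ε * g i) ≤ Fintype.card Ω * Real.exp (ε ^ 2 / 2) := by
    calc ∑ i, Real.exp (ε * g i)
        ≤ ∑ i, (Real.cosh ε + g i * Real.sinh ε) := by
          refine Finset.sum_le_sum fun i _ => ?_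
          rw [mul_comm]
          exact Real.exp_mul_le_cosh_add_mul_sinh (hg i) ε
      _ = Fintype.card Ω * Real.cosh ε := by
          rw [Finset.sum_add_distrib, ← Finset.sum_mul, hsum]
          simp
      _ ≤ _ := by gcongr; exact Real.cosh_le_exp_half_sq ε
  have hprod : ∑ s : Fin k → Ω, Real.exp (ε * ∑ j, g (s j)) =
      (∑ i, Real.exp (ε * g i)) ^ k := by
    rw [Fintype.sum_pow]
    exact Finset.sum_congr rfl fun s _ => by rw [Finset.mul_sum, Real.exp_sum]
  have hmarkov : ((Finset.univ.filter fun s : Fin k → Ω =>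
      (k : ℝ) * ε ≤ ∑ j, g (s j)).card : ℝ) * Real.exp (ε * (k * ε)) ≤
      ∑ s : Fin k → Ω, Real.exp (ε * ∑ j, g (s j)) := by
    rw [← nsmul_eq_mul]
    refine (Finset.card_nsmul_le_sum _ (fun s => Real.exp (ε * ∑ j, g (s j))) _
      fun s hs => ?_).trans
      (Finset.sum_le_univ_sum_of_nonneg fun s => (Real.exp_pos _).le)
    have hs := (Finset.mem_filter.mp hs).2
    gcongr
  have hpow : (∑ i, Real.exp (ε * g i)) ^ k ≤
      (Fintype.card Ω * Real.exp (ε ^ 2 / 2)) ^ k := by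
    gcongr
  have hexp : (Fintype.card Ω * Real.exp (ε ^ 2 / 2)) ^ k =
      Real.exp (-(k * ε ^ 2 / 2)) * (Fintype.card Ω : ℝ) ^ k * Real.exp (ε * (k * ε)) := by
    rw [mul_pow, ← Real.exp_nat_mul, mul_right_comm, ← Real.exp_add, mul_comm]
    ring_nf
  rw [hprod] at hmarkov
  exact le_of_mul_le_mul_right (hmarkov.trans (hpow.trans_eq hexp)) (Real.exp_pos _)

/-- Two-sided form of `card_le_sum_comp_le`. -/
theorem card_le_abs_sum_comp_le {Ω : Type*} [Fintype Ω] (g : Ω → ℝ) (hg : ∀ i, |g i| ≤ 1)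
    (hsum : ∑ i, g i = 0) {ε : ℝ} (hε : 0 ≤ ε) (k : ℕ) :
    ((Finset.univ.filter fun s : Fin k → Ω => (k : ℝ) * ε ≤ |∑ j, g (s j)|).card : ℝ) ≤
      2 * (Real.exp (-(k * ε ^ 2 / 2)) * (Fintype.card Ω : ℝ) ^ k) := by
  have hpos := card_le_sum_comp_le g hg hsum hε k
  have hneg := card_le_sum_comp_le (fun i => -g i) (by simpa using hg) (by simpa using hsum) hε k
  have hunion : (Finset.univ.filter fun s : Fin k → Ω => (k : ℝ) * ε ≤ |∑ j, g (s j)|) =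
      (Finset.univ.filter fun s : Fin k → Ω => (k : ℝ) * ε ≤ ∑ j, g (s j)) ∪
      (Finset.univ.filter fun s : Fin k → Ω => (k : ℝ) * ε ≤ ∑ j, -g (s j)) := by
    ext s
    simp [le_abs]
  rw [hunion, two_mul]
  refine le_trans ?_ (add_le_add hpos hneg)
  exact_mod_cast Finset.card_union_le _ _

/-- The number of sample sequences for which the empirical count of `a` misestimates `mult x a`
by at least `d` after rescaling. -/
theorem card_deviation_le {n M : ℕ} (hn : 1 ≤ n) (x : Fin n → Fin M) (a : Fin M) {d : ℝ}
    (hd : 0 ≤ d) (k : ℕ) :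
    ((Finset.univ.filter fun smp : Fin k → Fin n =>
      (k : ℝ) * d ≤ |(n : ℝ) * ((Finset.univ.filter fun j : Fin k => x (smp j) = a).card : ℝ) -
        (k : ℝ) * (mult x a : ℝ)|).card : ℝ) ≤
      2 * (Real.exp (-(k * (d / n) ^ 2 / 2)) * (n : ℝ) ^ k) := by
  have hn' : (0 : ℝ) < n := by exact_mod_cast hn
  have hmult : (mult x a : ℝ) ≤ n := by
    have h : mult x a ≤ n := by
      simpa [mult] using Finset.card_filter_le Finset.univ fun i => x i = a
    exact_mod_cast h
  have hp0 : 0 ≤ (mult x a : ℝ) / n := by positivity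
  have hp1 : (mult x a : ℝ) / n ≤ 1 := (div_le_one hn').2 hmult
  have h := card_le_abs_sum_comp_le
    (fun i => (if x i = a then (1 : ℝ) else 0) - (mult x a : ℝ) / n)
    (fun i => by
      rw [abs_le]
      split_ifs <;> constructor <;> linarith)
    (by
      rw [Finset.sum_sub_distrib, Finset.sum_boole]
      simp only [Finset.sum_const, Finset.card_univ, Fintype.card_fin, nsmul_eq_mul]
      rw [mul_div_cancel₀ _ hn'.ne']
      simp [mult])
    (div_nonneg hd hn'.le) k
  rw [Fintype.card_fin] at h
  refine le_of_eq_of_le ?_ h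
  congr 2
  ext smp
  simp only [Finset.mem_filter, Finset.mem_univ, true_and]
  rw [Finset.sum_sub_distrib, Finset.sum_boole]
  simp only [Finset.sum_const, Finset.card_univ, Fintype.card_fin, nsmul_eq_mul]
  have hscale (r t : ℝ) : r - k * (t / n) = (n * r - k * t) / n := by
    field_simp
  rw [hscale, abs_div, abs_of_pos hn', ← mul_div_assoc, div_le_div_iff_of_pos_right hn']

/-- sampling `k ≥ 3(n/d)² ln(6M)` uniform indices estimates every
multiplicity of `x` to within `d`, with probability at least `2/3`. -/
theorem type_estimation_sampling (n M : ℕ) (hn : 1 ≤ n) (hM : 1 ≤ M)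
    (x : Fin n → Fin M) (d : ℝ) (hd : 0 < d) (k : ℕ)
    (hk : 3 * ((n : ℝ) / d) ^ 2 * Real.log (6 * M) ≤ (k : ℝ)) :
    (2 / 3 : ℝ) ≤
      ((Finset.univ.filter fun smp : Fin k → Fin n =>
          ∀ a : Fin M,
            |(n : ℝ) * ((Finset.univ.filter fun j : Fin k => x (smp j) = a).card : ℝ) -
              (k : ℝ) * (mult x a : ℝ)| < (k : ℝ) * d).card : ℝ) / ((n : ℝ) ^ k) := by
  have hn' : (0 : ℝ) < n := by exact_mod_cast hn
  have hM' : (0 : ℝ) < M := by exact_mod_cast hM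
  have hM1 : (1 : ℝ) ≤ M := by exact_mod_cast hM
  have hlog : 0 ≤ Real.log (6 * M) := Real.log_nonneg (by linarith)
  have hk' : Real.log (6 * M) ≤ k * (d / n) ^ 2 / 2 := by
    have h := mul_le_mul_of_nonneg_right hk (sq_nonneg (d / n))
    have hcancel : 3 * ((n : ℝ) / d) ^ 2 * Real.log (6 * M) * (d / n) ^ 2 =
        3 * Real.log (6 * M) := by
      field_simp
    linarith
  have hexp : Real.exp (-(k * (d / n) ^ 2 / 2)) ≤ 1 / (6 * M) := by
    calc Real.exp (-(k * (d / n) ^ 2 / 2)) ≤ Real.exp (-Real.log (6 * M)) := by gcongr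
      _ = 1 / (6 * M) := by rw [Real.exp_neg, Real.exp_log (by positivity), one_div]
  set good := Finset.univ.filter fun smp : Fin k → Fin n =>
    ∀ a : Fin M,
      |(n : ℝ) * ((Finset.univ.filter fun j : Fin k => x (smp j) = a).card : ℝ) -
        (k : ℝ) * (mult x a : ℝ)| < (k : ℝ) * d with hgood
  let bad (a : Fin M) := Finset.univ.filter fun smp : Fin k → Fin n =>
    (k : ℝ) * d ≤ |(n : ℝ) * ((Finset.univ.filter fun j : Fin k => x (smp j) = a).card : ℝ) -
      (k : ℝ) * (mult x a : ℝ)|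
  have hcompl : goodᶜ ⊆ Finset.univ.biUnion bad := by
    intro smp hsmp
    simpa [hgood, bad] using hsmp
  have hbad : ((goodᶜ).card : ℝ) ≤ 1 / 3 * (n : ℝ) ^ k := by
    calc ((goodᶜ).card : ℝ) ≤ ∑ a, ((bad a).card : ℝ) := by
          exact_mod_cast (Finset.card_le_card hcompl).trans Finset.card_biUnion_le
      _ ≤ ∑ _a : Fin M, 2 * (1 / (6 * M) * (n : ℝ) ^ k) := by
          refine Finset.sum_le_sum fun a _ => (card_deviation_le hn x a hd.le k).trans ?_
          gcongr
      _ = 1 / 3 * (n : ℝ) ^ k := by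
          simp only [Finset.sum_const, Finset.card_univ, Fintype.card_fin, nsmul_eq_mul]
          field_simp
          norm_num
  have htotal : (good.card : ℝ) + ((goodᶜ).card : ℝ) = (n : ℝ) ^ k := by
    have h := Finset.card_add_card_compl good
    rw [Fintype.card_fun, Fintype.card_fin, Fintype.card_fin] at h
    exact_mod_cast h
  rw [le_div_iff₀ (by positivity)]
  linarith

end QCPaper
end

section
/- There exists a constant K > 0 such that for all n ≥ 1 and M ≥ 2, every symmetric set X ⊆ [M]^n, and every non-constant symmetric partial function f : X → Bool, the bounded-error randomized query complexity satisfies R(f) ≤ K · (n/d(f))² · log M. -/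
open scoped Classical

namespace QCPaper

/-- The tree which queries the indices `s 0, s 1, …` in order and outputs `g` of the answers. -/
def sampleTree {n M : ℕ} : (m : ℕ) → (Fin m → Fin n) → ((Fin m → Fin M) → Bool) → DTree n M
  | 0, _, g => .leaf (g Fin.elim0)
  | m + 1, s, g => .node (s 0) fun a => sampleTree m (Fin.tail s) fun r => g (Fin.cons a r)

theorem sampleTree_eval {n M : ℕ} (x : Fin n → Fin M) (m : ℕ) (s : Fin m → Fin n)
    (g : (Fin m → Fin M) → Bool) : (sampleTree m s g).eval x = g (x ∘ s) := by
  induction m with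
  | zero => exact congrArg g (Subsingleton.elim _ _)
  | succ m ih =>
    simp only [sampleTree, DTree.eval, ih]
    congr 1
    funext i
    refine Fin.cases ?_ (fun j => ?_) i <;> simp [Fin.tail]

theorem sampleTree_depth_le {n M : ℕ} (m : ℕ) (s : Fin m → Fin n)
    (g : (Fin m → Fin M) → Bool) : (sampleTree m s g).depth ≤ m := by
  induction m with
  | zero => simp [sampleTree, DTree.depth]
  | succ m ih =>
    simp only [sampleTree, DTree.depth]
    exact Nat.succ_le_succ (Finset.sup_le fun a _ => ih _ _)

/-- A Chernoff bound for sampling with replacement from a bounded centered population. -/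
theorem card_sample_sum_ge_le {n : ℕ} (m : ℕ) (z : Fin n → ℝ) (hz : ∀ i, |z i| ≤ 1)
    (hsum : ∑ i, z i = 0) {ε : ℝ} (hε : 0 ≤ ε) (hε2 : ε ≤ 2) :
    ((Finset.univ.filter fun s : Fin m → Fin n => m * ε ≤ ∑ k, z (s k)).card : ℝ)
      ≤ (n : ℝ) ^ m * Real.exp (-(m * ε ^ 2 / 4)) := by
  have hpt : ∀ i, Real.exp (ε / 2 * z i) ≤ 1 + ε / 2 * z i + (ε / 2) ^ 2 := by
    intro i
    have habs : |ε / 2 * z i| ≤ 1 := by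
      rw [abs_mul, abs_of_nonneg (by positivity)]
      exact mul_le_one₀ (by linarith) (abs_nonneg _) (hz i)
    have h := (abs_le.mp (Real.abs_exp_sub_one_sub_id_le habs)).2
    have hsq : (ε / 2 * z i) ^ 2 ≤ (ε / 2) ^ 2 := by
      rw [mul_pow]
      exact mul_le_of_le_one_right (by positivity) ((sq_le_one_iff_abs_le_one _).mpr (hz i))
    linarith
  have hmean : ∑ i, Real.exp (ε / 2 * z i) ≤ n * Real.exp ((ε / 2) ^ 2) := by
    calc ∑ i, Real.exp (ε / 2 * z i) ≤ ∑ i, (1 + ε / 2 * z i + (ε / 2) ^ 2) :=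
          Finset.sum_le_sum fun i _ => hpt i
      _ = n * ((ε / 2) ^ 2 + 1) := by
          simp only [Finset.sum_add_distrib, ← Finset.mul_sum, hsum]
          simp
          ring
      _ ≤ _ := by gcongr; exact Real.add_one_le_exp _
  have hmgf : ∑ s : Fin m → Fin n, Real.exp (ε / 2 * ∑ k, z (s k))
      ≤ (n : ℝ) ^ m * Real.exp (m * (ε / 2) ^ 2) := by
    calc ∑ s : Fin m → Fin n, Real.exp (ε / 2 * ∑ k, z (s k))
        = (∑ i, Real.exp (ε / 2 * z i)) ^ m := by
          rw [Fintype.sum_pow]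
          simp only [Finset.mul_sum, Real.exp_sum]
      _ ≤ (n * Real.exp ((ε / 2) ^ 2)) ^ m := by gcongr
      _ = _ := by rw [mul_pow, ← Real.exp_nat_mul]
  have hmarkov : ((Finset.univ.filter fun s : Fin m → Fin n =>
      m * ε ≤ ∑ k, z (s k)).card : ℝ) * Real.exp (ε / 2 * (m * ε))
      ≤ ∑ s : Fin m → Fin n, Real.exp (ε / 2 * ∑ k, z (s k)) := by
    rw [← nsmul_eq_mul]
    refine (Finset.card_nsmul_le_sum _ (fun s => Real.exp (ε / 2 * ∑ k, z (s k))) _ ?_).trans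
      (Finset.sum_le_sum_of_subset_of_nonneg (Finset.filter_subset _ _)
        fun _ _ _ => (Real.exp_pos _).le)
    intro s hs
    have := (Finset.mem_filter.mp hs).2
    gcongr
  rw [← mul_le_mul_iff_left₀ (Real.exp_pos (ε / 2 * (m * ε))), mul_assoc, ← Real.exp_add]
  refine (hmarkov.trans hmgf).trans (le_of_eq ?_)
  congr 2
  ring

theorem sum_ite_eq_mult {n M : ℕ} (x : Fin n → Fin M) (a : Fin M) :
    ∑ i, (if x i = a then (1 : ℝ) else 0) = mult x a := by
  simp [mult]

theorem mult_le {n M : ℕ} (x : Fin n → Fin M) (a : Fin M) : mult x a ≤ n := by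
  simpa [mult] using Finset.card_filter_le (Finset.univ : Finset (Fin n)) (fun i => x i = a)

/-- The frequency of every letter in `y` differs from its frequency in `x` by less than `ε`. -/
def FreqClose {n m M : ℕ} (ε : ℝ) (y : Fin m → Fin M) (x : Fin n → Fin M) : Prop :=
  ∀ a, |(mult y a : ℝ) - m * (mult x a / n)| < m * ε

theorem card_not_freqClose_le {n M : ℕ} (hn : 1 ≤ n) (m : ℕ) (x : Fin n → Fin M) {ε : ℝ}
    (hε : 0 ≤ ε) (hε2 : ε ≤ 2) :
    ((Finset.univ.filter fun s : Fin m → Fin n => ¬ FreqClose ε (x ∘ s) x).card : ℝ)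
      ≤ M * (2 * ((n : ℝ) ^ m * Real.exp (-(m * ε ^ 2 / 4)))) := by
  have hn' : (0 : ℝ) < n := by exact_mod_cast hn
  let z : Fin M → Fin n → ℝ := fun a i => (if x i = a then 1 else 0) - mult x a / n
  have hz : ∀ a i, |z a i| ≤ 1 := by
    intro a i
    have h0 : (0 : ℝ) ≤ mult x a / n := by positivity
    have h1 : (mult x a : ℝ) / n ≤ 1 :=
      (div_le_one hn').mpr (by exact_mod_cast mult_le x a)
    simp only [z]
    split_ifs <;> rw [abs_le] <;> constructor <;> linarith
  have hsum : ∀ a, ∑ i, z a i = 0 := by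
    intro a
    simp only [z, Finset.sum_sub_distrib, sum_ite_eq_mult]
    simp
    field_simp
    simp
  have hsample : ∀ a (s : Fin m → Fin n),
      ∑ k, z a (s k) = (mult (x ∘ s) a : ℝ) - m * (mult x a / n) := by
    intro a s
    simp only [z, Finset.sum_sub_distrib]
    rw [← sum_ite_eq_mult (x ∘ s) a]
    simp
  have hsub : (Finset.univ.filter fun s : Fin m → Fin n => ¬ FreqClose ε (x ∘ s) x) ⊆
      Finset.univ.biUnion fun a =>
        (Finset.univ.filter fun s : Fin m → Fin n => m * ε ≤ ∑ k, z a (s k)) ∪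
        (Finset.univ.filter fun s : Fin m → Fin n => m * ε ≤ ∑ k, (fun i => -z a i) (s k)) := by
    intro s hs
    obtain ⟨a, ha⟩ := not_forall.mp (Finset.mem_filter.mp hs).2
    rw [not_lt, ← hsample, le_abs] at ha
    simp only [Finset.mem_biUnion, Finset.mem_univ, true_and, Finset.mem_union,
      Finset.mem_filter, Finset.sum_neg_distrib]
    exact ⟨a, ha⟩
  have hcard := (Finset.card_le_card hsub).trans Finset.card_biUnion_le
  have hletter : ∀ a,
      ((((Finset.univ.filter fun s : Fin m → Fin n => m * ε ≤ ∑ k, z a (s k)) ∪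
        (Finset.univ.filter fun s : Fin m → Fin n =>
          m * ε ≤ ∑ k, (fun i => -z a i) (s k))).card : ℕ) : ℝ)
        ≤ 2 * ((n : ℝ) ^ m * Real.exp (-(m * ε ^ 2 / 4))) := by
    intro a
    have h1 := card_sample_sum_ge_le m (z a) (hz a) (hsum a) hε hε2
    have h2 := card_sample_sum_ge_le m (fun i => -z a i) (fun i => by rw [abs_neg]; exact hz a i)
      (by rw [Finset.sum_neg_distrib, hsum, neg_zero]) hε hε2
    have h3 := Finset.card_union_le
      (Finset.univ.filter fun s : Fin m → Fin n => m * ε ≤ ∑ k, z a (s k))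
      (Finset.univ.filter fun s : Fin m → Fin n => m * ε ≤ ∑ k, (fun i => -z a i) (s k))
    have h3' := (Nat.cast_le (α := ℝ)).mpr h3
    rw [Nat.cast_add] at h3'
    linarith
  refine ((Nat.cast_le (α := ℝ)).mpr hcard).trans ?_
  rw [Nat.cast_sum]
  refine (Finset.sum_le_sum fun a _ => hletter a).trans (le_of_eq ?_)
  simp

theorem randR_le_of_family {n M : ℕ} {ι : Type*} [Fintype ι] [Nonempty ι]
    (X : Set (Fin n → Fin M)) (f : (Fin n → Fin M) → Bool) (t : ι → DTree n M) (m : ℕ)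
    (hdepth : ∀ s, (t s).depth ≤ m)
    (herr : ∀ x ∈ X, ((Finset.univ.filter fun s => (t s).eval x ≠ f x).card : ℝ)
      ≤ Fintype.card ι / 3) :
    randR X f ≤ m := by
  have hpos : (0 : ℝ) < Fintype.card ι := by exact_mod_cast Fintype.card_pos
  let e := Fintype.equivFin ι
  let A : RandAlg n M :=
    { N := Fintype.card ι
      tree := fun j => t (e.symm j)
      prob := fun _ => (Fintype.card ι : ℝ)⁻¹
      nonneg := fun _ => by positivity
      sum_one := by simp }
  have hA : BoundedError X f A := by
    intro x hx
    have hgood : (Finset.univ.filter fun j => (A.tree j).eval x = f x).card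
        = (Finset.univ.filter fun s => (t s).eval x = f x).card := by
      refine Finset.card_bij (fun j _ => e.symm j) ?_ ?_ ?_
      · intro j hj
        simpa [A] using hj
      · intro j _ k _ h
        exact e.symm.injective h
      · intro s hs
        exact ⟨e s, by simpa [A] using hs, by simp⟩
    have hsplit : ((Finset.univ.filter fun s => (t s).eval x = f x).card : ℝ)
        + ((Finset.univ.filter fun s => (t s).eval x ≠ f x).card : ℝ) = Fintype.card ι := by
      exact_mod_cast Finset.card_filter_add_card_filter_not (s := Finset.univ)
        fun s => (t s).eval x = f x
    have h := herr x hx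
    rw [Finset.sum_const, nsmul_eq_mul, hgood]
    change (2 / 3 : ℝ) ≤ _ * (Fintype.card ι : ℝ)⁻¹
    rw [← div_eq_mul_inv, le_div_iff₀ hpos]
    linarith
  exact (Nat.sInf_le ⟨A, hA, rfl⟩ : randR X f ≤ suppDepth A).trans
    (Finset.sup_le fun j _ => hdepth _)

theorem dgap_le_sup_dist {n M : ℕ} {X : Set (Fin n → Fin M)} {f : (Fin n → Fin M) → Bool}
    {x y : Fin n → Fin M} (hx : x ∈ X) (hy : y ∈ X) (h : f x ≠ f y) :
    dgap X f ≤ Finset.univ.sup fun a => Nat.dist (mult x a) (mult y a) :=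
  Nat.sInf_le ⟨x, hx, y, hy, h, rfl⟩

theorem typeOf_eq_of_mult_eq {n M : ℕ} {x y : Fin n → Fin M} (h : ∀ a, mult x a = mult y a) :
    typeOf x = typeOf y := by
  ext a
  have hcount : ∀ w : Fin n → Fin M, Multiset.count a (typeOf w) = mult w a := by
    intro w
    simp only [typeOf, mult, Multiset.count_map, Finset.card_def, Finset.filter_val, eq_comm]
  rw [hcount, hcount, h]

theorem dgap_pos {n M : ℕ} {X : Set (Fin n → Fin M)} {f : (Fin n → Fin M) → Bool}
    (hf : SymmetricFun X f) (hne : ∃ x ∈ X, ∃ y ∈ X, f x ≠ f y) : 1 ≤ dgap X f := by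
  obtain ⟨x₀, hx₀, y₀, hy₀, h₀⟩ := hne
  obtain ⟨x, hx, y, hy, h, hd⟩ : dgap X f ∈ {d | ∃ x ∈ X, ∃ y ∈ X, f x ≠ f y ∧
      (Finset.univ.sup fun a => Nat.dist (mult x a) (mult y a)) = d} :=
    Nat.sInf_mem ⟨_, x₀, hx₀, y₀, hy₀, h₀, rfl⟩
  by_contra hlt
  refine h (hf x hx y hy (typeOf_eq_of_mult_eq fun a => Nat.eq_of_dist_eq_zero ?_))
  have := Finset.le_sup (f := fun a => Nat.dist (mult x a) (mult y a)) (Finset.mem_univ a)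
  omega

theorem dgap_le {n M : ℕ} {X : Set (Fin n → Fin M)} {f : (Fin n → Fin M) → Bool}
    (hne : ∃ x ∈ X, ∃ y ∈ X, f x ≠ f y) : dgap X f ≤ n := by
  obtain ⟨x, hx, y, hy, h⟩ := hne
  refine (dgap_le_sup_dist hx hy h).trans (Finset.sup_le fun a _ => ?_)
  have h1 := mult_le x a
  have h2 := mult_le y a
  simp only [Nat.dist]
  omega

/-- Two inputs whose letter frequencies are both close to those of one sample have the same
value. -/
theorem eq_of_freqClose {n m M : ℕ} (hn : 1 ≤ n) {X : Set (Fin n → Fin M)}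
    {f : (Fin n → Fin M) → Bool} (hd : 1 ≤ dgap X f) {x y : Fin n → Fin M}
    (hx : x ∈ X) (hy : y ∈ X) {w : Fin m → Fin M}
    (hwx : FreqClose ((dgap X f : ℝ) / (2 * n)) w x)
    (hwy : FreqClose ((dgap X f : ℝ) / (2 * n)) w y) : f x = f y := by
  by_contra h
  have hn' : (0 : ℝ) < n := by exact_mod_cast hn
  refine absurd (dgap_le_sup_dist hx hy h) (not_le.mpr ((Finset.sup_lt_iff (Nat.bot_eq_zero ▸ hd)).mpr
    fun a _ => ?_))
  have h1 := hwx a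
  have h2 := hwy a
  have hm : (0 : ℝ) < m := by
    rcases (Nat.cast_nonneg m : (0 : ℝ) ≤ m).eq_or_lt with h0 | h0
    · exact absurd h1 (by rw [← h0]; simp)
    · exact h0
  have h3 : |(m : ℝ) * (mult x a / n) - m * (mult y a / n)| < m * ((dgap X f : ℝ) / n) := by
    have e : (m : ℝ) * ((dgap X f : ℝ) / n)
        = m * ((dgap X f : ℝ) / (2 * n)) + m * ((dgap X f : ℝ) / (2 * n)) := by
      field_simp
      ring
    rw [abs_lt] at h1 h2 ⊢
    constructor <;> linarith
  rw [← mul_sub, ← sub_div, abs_mul, abs_div, abs_of_pos hm, abs_of_pos hn',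
    mul_lt_mul_iff_right₀ hm, div_lt_div_iff_of_pos_right hn', abs_lt] at h3
  have h4 : (mult x a : ℝ) < mult y a + dgap X f := by linarith
  have h5 : (mult y a : ℝ) < mult x a + dgap X f := by linarith
  norm_cast at h4 h5
  simp only [Nat.dist]
  omega

/-- for every non-constant symmetric partial function `f` on a symmetric
promise, `R(f) ≤ K · (n / d(f))² · log M`. -/
theorem randR_le_of_symmetric : ∃ K : ℝ, 0 < K ∧
    ∀ (n M : ℕ), 1 ≤ n → 2 ≤ M →
    ∀ X : Set (Fin n → Fin M), SymmetricSet X →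
    ∀ f : (Fin n → Fin M) → Bool, SymmetricFun X f →
      (∃ x ∈ X, ∃ y ∈ X, f x ≠ f y) →
      (randR X f : ℝ) ≤ K * ((n : ℝ) / (dgap X f : ℝ)) ^ 2 * Real.log M := by
  refine ⟨66, by norm_num, fun n M hn hM X _ f hf hne => ?_⟩
  have hd := dgap_pos hf hne
  have hdn := dgap_le hne
  have hn' : (0 : ℝ) < n := by exact_mod_cast hn
  have hd' : (0 : ℝ) < dgap X f := by exact_mod_cast hd
  have hdn' : (dgap X f : ℝ) ≤ n := by exact_mod_cast hdn
  have hM' : (2 : ℝ) ≤ M := by exact_mod_cast hM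
  have : Nonempty (Fin n) := ⟨⟨0, hn⟩⟩
  have hlog : (1 / 2 : ℝ) ≤ Real.log M := by
    have h1 := Real.log_two_gt_d9
    have h2 := Real.log_le_log (by norm_num) hM'
    linarith
  set q : ℝ := ((n : ℝ) / (dgap X f : ℝ)) ^ 2 with hq
  have hq1 : 1 ≤ q := one_le_pow₀ ((one_le_div hd').mpr hdn')
  set m : ℕ := ⌈64 * q * Real.log M⌉₊ with hm
  set ε : ℝ := (dgap X f : ℝ) / (2 * n) with hε
  have hε0 : 0 ≤ ε := by positivity
  have hε2 : ε ≤ 2 := by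
    rw [hε, div_le_iff₀ (by positivity)]
    linarith
  have hexp : M * (2 * Real.exp (-(m * ε ^ 2 / 4))) ≤ 1 / 3 := by
    have hqε : q * ε ^ 2 = 1 / 4 := by
      rw [hq, hε]
      field_simp
      norm_num
    have hle : 4 * Real.log M ≤ m * ε ^ 2 / 4 := by
      have h := mul_le_mul_of_nonneg_right (Nat.le_ceil (64 * q * Real.log M)) (sq_nonneg ε)
      have e : 64 * q * Real.log M * ε ^ 2 = 64 * (q * ε ^ 2) * Real.log M := by ring
      rw [e, hqε] at h
      linarith
    have hpow : Real.exp (-(m * ε ^ 2 / 4)) ≤ ((M : ℝ) ^ 4)⁻¹ := by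
      rw [← Real.exp_log (show (0 : ℝ) < (M : ℝ) ^ 4 by positivity), ← Real.exp_neg,
        Real.exp_le_exp, Real.log_pow]
      push_cast
      linarith
    have h8 : (2 : ℝ) ^ 3 ≤ (M : ℝ) ^ 3 := by gcongr
    calc M * (2 * Real.exp (-(m * ε ^ 2 / 4))) ≤ M * (2 * ((M : ℝ) ^ 4)⁻¹) := by gcongr
      _ = 2 / (M : ℝ) ^ 3 := by field_simp
      _ ≤ 1 / 3 := by
        rw [div_le_div_iff₀ (by positivity) (by norm_num)]
        linarith
  let g : (Fin m → Fin M) → Bool := fun w => decide (∃ y ∈ X, f y = true ∧ FreqClose ε w y)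
  have hR : randR X f ≤ m := by
    refine randR_le_of_family X f (fun s : Fin m → Fin n => sampleTree m s g) m
      (fun s => sampleTree_depth_le m s g) fun x hx => ?_
    have hsub : (Finset.univ.filter fun s : Fin m → Fin n => (sampleTree m s g).eval x ≠ f x) ⊆
        Finset.univ.filter fun s : Fin m → Fin n => ¬ FreqClose ε (x ∘ s) x := by
      refine Finset.monotone_filter_right _ fun s _ hs hclose => hs ?_
      rw [sampleTree_eval]
      cases hfx : f x
      · refine decide_eq_false ?_
        rintro ⟨y, hy, hfy, hyc⟩
        have := eq_of_freqClose hn hd hx hy hclose hyc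
        simp [hfx, hfy] at this
      · exact decide_eq_true ⟨x, hx, hfx, hclose⟩
    refine ((Nat.cast_le (α := ℝ)).mpr (Finset.card_le_card hsub)).trans ?_
    refine (card_not_freqClose_le hn m x hε0 hε2).trans ?_
    have h := mul_le_mul_of_nonneg_left hexp (show (0 : ℝ) ≤ (n : ℝ) ^ m by positivity)
    simp only [Fintype.card_fun, Fintype.card_fin, Nat.cast_pow]
    linarith
  have hqlog : 1 / 2 ≤ q * Real.log M := by nlinarith
  have hceil := Nat.ceil_lt_add_one (show 0 ≤ 64 * q * Real.log M by nlinarith)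
  have hR' : (randR X f : ℝ) ≤ m := by exact_mod_cast hR
  linarith

end QCPaper
end
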